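/- arXiv:1506.01981 — 2 statements merged into one kernel-verified Lean document; each statement's English description precedes it below -/
import Mathlib

section
/- For all positive integers p and q, the group presented by generators ρ₀, ρ₁, ρ₂ and relations ρ₀² = ρ₁² = ρ₂² = (ρ₀ρ₂)² = (ρ₀ρ₁)^p = (ρ₁ρ₂)^q = 1 (the full (2, p, q) triangle Coxeter group) has property FA. -/
universe u

/-- A group `G` has property FA if for every action of `G` by graph automorphisms on a
nonempty tree `T`, there is a vertex fixed by all of `G` or an edge of `T` that is
setwise invariant under all of `G`. -/
def HasPropertyFA (G : Type*) [Group G] : Prop :=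
  ∀ (V : Type u) (T : SimpleGraph V), T.Connected → T.IsAcyclic →
    ∀ φ : G →* Equiv.Perm V, (∀ (g : G) (v w : V), T.Adj (φ g v) (φ g w) ↔ T.Adj v w) →
      (∃ v : V, ∀ g : G, φ g v = v) ∨
        (∃ v w : V, T.Adj v w ∧ ∀ g : G, ({φ g v, φ g w} : Set V) = {v, w})

/-- The relators of the full (2, p, q) triangle Coxeter group on generators
`ρ₀, ρ₁, ρ₂`. -/
def coxeterTriangleRels (p q : ℕ) : Set (FreeGroup (Fin 3)) :=
  { (FreeGroup.of 0) ^ 2, (FreeGroup.of 1) ^ 2, (FreeGroup.of 2) ^ 2,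
    (FreeGroup.of 0 * FreeGroup.of 2) ^ 2,
    (FreeGroup.of 0 * FreeGroup.of 1) ^ p,
    (FreeGroup.of 1 * FreeGroup.of 2) ^ q }

namespace SimpleGraph

variable {V : Type*} {T : SimpleGraph V}

lemma Connected.exists_adj_dist_add_one_eq (hT : T.Connected) {b v : V} (h : b ≠ v) :
    ∃ u, T.Adj u v ∧ T.dist b u + 1 = T.dist b v := by
  obtain ⟨p, hp⟩ := hT.exists_walk_length_eq_dist v b
  cases p with
  | nil => exact absurd rfl h
  | @cons _ u _ huv q =>
    refine ⟨u, huv.symm, ?_⟩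
    have h₁ := T.dist_le q
    have h₂ := hT.dist_triangle (u := v) (v := u) (w := b)
    have h₃ := dist_eq_one_iff_adj.mpr huv
    rw [Walk.length_cons] at hp
    rw [T.dist_comm (u := b) (v := u), T.dist_comm (u := b) (v := v)]
    omega

lemma IsTree.eq_of_adj_of_dist_add_one_eq (hT : T.IsTree) {b u w v : V} (hu : T.Adj u v)
    (hw : T.Adj w v) (hdu : T.dist b u + 1 = T.dist b v) (hdw : T.dist b w + 1 = T.dist b v) :
    u = w := by
  obtain ⟨p, hp⟩ := hT.connected.exists_walk_length_eq_dist b u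
  obtain ⟨q, hq⟩ := hT.connected.exists_walk_length_eq_dist b w
  have hp' : (p.concat hu).IsPath := Walk.isPath_of_length_eq_dist _ (by simp [hp, hdu])
  have hq' : (q.concat hw).IsPath := Walk.isPath_of_length_eq_dist _ (by simp [hq, hdw])
  have h := (hT.existsUnique_path b v).unique hp' hq'
  simpa using congrArg Walk.penultimate h

/-- In a tree, a point of a geodesic is determined by its distance to an endpoint. -/
lemma IsTree.eq_of_dist_eq_of_dist_add_dist_eq (hT : T.IsTree) {b c x y : V}
    (hx : T.dist b x + T.dist x c = T.dist b c) (hy : T.dist b y + T.dist y c = T.dist b c)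
    (hxy : T.dist b x = T.dist b y) : x = y := by
  induction hn : T.dist c x generalizing x y with
  | zero =>
    have h₁ : T.dist c y = 0 := by
      rw [T.dist_comm (u := x)] at hx
      rw [T.dist_comm (u := y)] at hy
      omega
    exact (hT.connected.dist_eq_zero_iff.mp hn).symm.trans (hT.connected.dist_eq_zero_iff.mp h₁)
  | succ n ih =>
    have hcy : T.dist c y = n + 1 := by
      rw [T.dist_comm (u := x)] at hx
      rw [T.dist_comm (u := y)] at hy
      omega
    have key : ∀ z, T.dist b z + T.dist z c = T.dist b c → T.dist c z = n + 1 →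
        ∃ z', T.Adj z z' ∧ T.dist b z' = T.dist b z + 1 ∧ T.dist c z' = n ∧
          T.dist b z' + T.dist z' c = T.dist b c := by
      intro z hz hcz
      obtain ⟨z', hadj, hz'⟩ := hT.connected.exists_adj_dist_add_one_eq (b := c) (v := z)
        (by rintro rfl; simp at hcz)
      have := hT.dist_eq_dist_add_one_of_adj b hadj
      have := hT.connected.dist_triangle (u := b) (v := z') (w := c)
      rw [T.dist_comm (u := z)] at hz
      rw [T.dist_comm (u := z')] at this
      refine ⟨z', hadj.symm, ?_, ?_, ?_⟩ <;> (try rw [T.dist_comm (u := z')]) <;> omega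
    obtain ⟨x', hxx, hbx, hcx, hx'⟩ := key x hx hn
    obtain ⟨y', hyy, hby, hcy', hy'⟩ := key y hy hcy
    obtain rfl := ih hx' hy' (by omega) hcx
    exact hT.eq_of_adj_of_dist_add_one_eq hxx hyy hbx.symm hby.symm

/-- If an edge `xy` points away from `b` and away from `c` in opposite directions, then it lies on
the geodesic from `b` to `c`. -/
lemma IsTree.dist_eq_of_adj (hT : T.IsTree) {b c x y : V} (hxy : T.Adj x y)
    (hb : T.dist b y = T.dist b x + 1) (hc : T.dist c x = T.dist c y + 1) :
    T.dist b c = T.dist b y + T.dist y c := by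
  induction hn : T.dist y c generalizing c with
  | zero => rw [hT.connected.dist_eq_zero_iff.mp hn, add_zero]
  | succ n ih =>
    obtain ⟨c', hadj, hc'⟩ := hT.connected.exists_adj_dist_add_one_eq (b := y) (v := c)
      (by rintro rfl; simp at hn)
    have h₁ := hT.dist_eq_dist_add_one_of_adj x hadj
    have h₂ := hT.connected.dist_triangle (u := x) (v := y) (w := c')
    have h₃ := dist_eq_one_iff_adj.mpr hxy
    simp only [T.dist_comm (u := c)] at hc
    have ih' := ih (c := c') (by simp only [T.dist_comm (u := c')]; omega) (by omega)
    rcases hT.dist_eq_dist_add_one_of_adj b hadj with h | h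
    · exfalso
      -- `c` would be the neighbour of `c'` closer to `b`, hence also closer to `y`
      obtain ⟨z, hz, hyz⟩ | hyc : (∃ z, T.Adj z c' ∧ T.dist y z + 1 = T.dist y c') ∨ y = c' := by
        by_cases hyc : y = c'
        · exact .inr hyc
        · exact .inl (hT.connected.exists_adj_dist_add_one_eq hyc)
      · have h₄ := hT.connected.dist_triangle (u := b) (v := y) (w := z)
        have h₅ := hT.dist_eq_dist_add_one_of_adj b hz
        have := hT.eq_of_adj_of_dist_add_one_eq (b := b) hz hadj.symm (by omega) (by omega)
        subst this
        omega
      · subst hyc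
        have := hT.eq_of_adj_of_dist_add_one_eq (b := b) hxy hadj.symm (by omega) (by omega)
        subst this
        simp at hc
    · omega

/-- Any three vertices of a tree have a median. -/
lemma IsTree.exists_median (hT : T.IsTree) (a b c : V) :
    ∃ m, T.dist a m + T.dist m b = T.dist a b ∧ T.dist b m + T.dist m c = T.dist b c ∧
      T.dist c m + T.dist m a = T.dist c a := by
  induction hn : T.dist b a generalizing a with
  | zero =>
    obtain rfl := hT.connected.dist_eq_zero_iff.mp hn
    exact ⟨b, by simp⟩
  | succ n ih =>
    obtain ⟨a', hadj, ha'⟩ := hT.connected.exists_adj_dist_add_one_eq (b := b) (v := a)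
      (by rintro rfl; simp at hn)
    rcases hT.dist_eq_dist_add_one_of_adj c hadj with h | h
    · exact ⟨a, by simp [T.dist_comm],
        (hT.dist_eq_of_adj hadj ha'.symm h).symm, by simp⟩
    · obtain ⟨m, h₁, h₂, h₃⟩ := ih a' (by omega)
      have h₄ := dist_eq_one_iff_adj.mpr hadj
      have h₅ := hT.connected.dist_triangle (u := m) (v := a') (w := a)
      have h₆ := hT.connected.dist_triangle (u := b) (v := m) (w := a)
      have h₇ := hT.connected.dist_triangle (u := c) (v := m) (w := a)
      refine ⟨m, ?_, h₂, ?_⟩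
      · have e₁ := T.dist_comm (u := a) (v := m)
        have e₂ := T.dist_comm (u := a) (v := b)
        have e₃ := T.dist_comm (u := a') (v := m)
        have e₄ := T.dist_comm (u := a') (v := b)
        have e₅ := T.dist_comm (u := m) (v := b)
        omega
      · omega

lemma Iso.dist_le {V' : Type*} {T' : SimpleGraph V'} (g : T ≃g T') (hT : T.Connected) (v w : V) :
    T'.dist (g v) (g w) ≤ T.dist v w := by
  obtain ⟨p, hp⟩ := hT.exists_walk_length_eq_dist v w
  simpa [hp] using T'.dist_le (p.map g.toHom)

lemma Iso.dist_apply {V' : Type*} {T' : SimpleGraph V'} (g : T ≃g T') (hT : T.Connected)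
    (v w : V) : T'.dist (g v) (g w) = T.dist v w :=
  le_antisymm (g.dist_le hT v w)
    (by simpa using g.symm.dist_le (g.connected_iff.mp hT) (g v) (g w))

/-- The fixed-point set of a tree automorphism is convex. -/
lemma IsTree.apply_eq_of_dist_add_dist_eq (hT : T.IsTree) (g : T ≃g T) {x y m : V} (hx : g x = x)
    (hy : g y = y) (hm : T.dist x m + T.dist m y = T.dist x y) : g m = m := by
  have h₁ := g.dist_apply hT.connected x m
  have h₂ := g.dist_apply hT.connected m y
  rw [hx] at h₁
  rw [hy] at h₂
  exact hT.eq_of_dist_eq_of_dist_add_dist_eq (by omega) hm h₁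

/-- A tree automorphism with a fixed vertex does not invert any edge. -/
lemma IsTree.apply_ne_of_adj (hT : T.IsTree) (g : T ≃g T) {x v w : V} (hx : g x = x)
    (hvw : T.Adj v w) : g v ≠ w := by
  rintro rfl
  have := g.dist_apply hT.connected x v
  rw [hx] at this
  exact hT.dist_ne_of_adj x hvw this.symm

/-- A tree automorphism inverts at most one edge. -/
lemma IsTree.pair_eq_of_swap (hT : T.IsTree) (g : T ≃g T) {a b c d : V} (hab : T.Adj a b)
    (hcd : T.Adj c d) (ha : g a = b) (hb : g b = a) (hc : g c = d) :
    ({a, b} : Set V) = {c, d} := by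
  wlog h : T.dist c b = T.dist c a + 1 generalizing a b
  · rw [Set.pair_comm a b]
    exact this hab.symm hb ha ((hT.dist_eq_dist_add_one_of_adj c hab).resolve_right h)
  have h₁ := g.dist_apply hT.connected c a
  have h₂ := g.dist_apply hT.connected c b
  rw [hc, ha] at h₁
  rw [hc, hb] at h₂
  have h₃ := hT.dist_eq_of_adj (b := c) (c := d) hab h (by omega)
  rw [dist_eq_one_iff_adj.mpr hcd] at h₃
  have h₄ : c = a := hT.connected.dist_eq_zero_iff.mp (by omega)
  subst h₄
  rw [← ha, ← hc]

/-- The sum of squared distances to a finite set is strictly convex along the paths of a tree. -/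
lemma IsTree.sum_sq_dist_add_lt (hT : T.IsTree) {s : Finset V} (hs : s.Nonempty) {u x y : V}
    (hx : T.Adj x u) (hy : T.Adj y u) (hxy : x ≠ y) :
    (∑ z ∈ s, T.dist z u ^ 2) + (∑ z ∈ s, T.dist z u ^ 2) <
      (∑ z ∈ s, T.dist z x ^ 2) + ∑ z ∈ s, T.dist z y ^ 2 := by
  simp only [← Finset.sum_add_distrib]
  refine Finset.sum_lt_sum_of_nonempty hs fun z _ ↦ ?_
  rcases hT.dist_eq_dist_add_one_of_adj z hx with h₁ | h₁ <;>
  rcases hT.dist_eq_dist_add_one_of_adj z hy with h₂ | h₂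
  · rw [h₁, h₂]
    nlinarith
  · rw [h₁, h₂]
    nlinarith
  · rw [h₂, h₁]
    nlinarith
  · exact absurd (hT.eq_of_adj_of_dist_add_one_eq hx hy h₁.symm h₂.symm) hxy

/-- Two vertices minimizing the sum of squared distances to a finite set are adjacent. -/
lemma IsTree.adj_of_sum_sq_dist_minimal (hT : T.IsTree) {s : Finset V} (hs : s.Nonempty) {v w : V}
    (hv : ∀ u, ∑ z ∈ s, T.dist z v ^ 2 ≤ ∑ z ∈ s, T.dist z u ^ 2)
    (hw : ∀ u, ∑ z ∈ s, T.dist z w ^ 2 ≤ ∑ z ∈ s, T.dist z u ^ 2) (hvw : v ≠ w) :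
    T.Adj v w := by
  have key : ∀ (n : ℕ) (x y : V), T.Adj y x → T.dist v y = n + 1 → T.dist v x = n + 2 →
      ∑ z ∈ s, T.dist z y ^ 2 < ∑ z ∈ s, T.dist z x ^ 2 := by
    intro n
    induction n with
    | zero =>
      intro x y hyx hy hx
      have hvy : T.Adj v y := dist_eq_one_iff_adj.mp hy
      have := hT.sum_sq_dist_add_lt hs hvy hyx.symm (by rintro rfl; simp at hx)
      have := hv y
      omega
    | succ n ih =>
      intro x y hyx hy hx
      obtain ⟨u, huy, hu⟩ := hT.connected.exists_adj_dist_add_one_eq (b := v) (v := y)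
        (by rintro rfl; simp at hy)
      have := hT.sum_sq_dist_add_lt hs huy hyx.symm (by rintro rfl; omega)
      have := ih y u huy (by omega) (by omega)
      omega
  by_contra hadj
  have h₁ := hT.connected.one_lt_dist_of_ne_of_not_adj hvw hadj
  obtain ⟨u, huw, hu⟩ := hT.connected.exists_adj_dist_add_one_eq hvw
  have := key (T.dist v w - 2) w u huw (by omega) (by omega)
  exact this.not_ge (hw u)

/-- A finite nonempty set of vertices of a tree has a center, which is a vertex or an edge
preserved by all automorphisms preserving the set. -/
lemma IsTree.exists_center (hT : T.IsTree) {s : Set V} (hs : s.Finite) (hne : s.Nonempty) :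
    ∃ v w, (v = w ∨ T.Adj v w) ∧
      ∀ g : T ≃g T, Set.MapsTo g s s → ({g v, g w} : Set V) = {v, w} := by
  classical
  lift s to Finset V using hs
  rw [Finset.coe_nonempty] at hne
  obtain ⟨v, -, hv⟩ := exists_minimalFor_of_wellFoundedLT (fun _ : V ↦ True)
    (fun u ↦ ∑ z ∈ s, T.dist z u ^ 2) ⟨hne.choose, trivial⟩
  replace hv : ∀ u, ∑ z ∈ s, T.dist z v ^ 2 ≤ ∑ z ∈ s, T.dist z u ^ 2 := fun u ↦
    (le_total _ _).elim id (hv trivial)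
  have hg : ∀ g : T ≃g T, Set.MapsTo g s s → ∀ u,
      ∑ z ∈ s, T.dist z (g u) ^ 2 = ∑ z ∈ s, T.dist z u ^ 2 := by
    intro g hgs u
    have himage : s.image g = s := Finset.eq_of_subset_of_card_le
      (Finset.image_subset_iff.mpr hgs) (Finset.card_image_of_injective s g.injective).ge
    conv_lhs => rw [← himage]
    rw [Finset.sum_image g.injective.injOn]
    simp_rw [g.dist_apply hT.connected]
  by_cases hw : ∃ w, v ≠ w ∧ ∀ u, ∑ z ∈ s, T.dist z w ^ 2 ≤ ∑ z ∈ s, T.dist z u ^ 2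
  · obtain ⟨w, hvw, hw⟩ := hw
    have hadj := hT.adj_of_sum_sq_dist_minimal hne hv hw hvw
    have honly : ∀ x, (∀ u, ∑ z ∈ s, T.dist z x ^ 2 ≤ ∑ z ∈ s, T.dist z u ^ 2) →
        x = v ∨ x = w := by
      intro x hx
      by_contra! h
      have h₁ := dist_eq_one_iff_adj.mpr (hT.adj_of_sum_sq_dist_minimal hne hx hv h.1)
      have h₂ := dist_eq_one_iff_adj.mpr (hT.adj_of_sum_sq_dist_minimal hne hx hw h.2)
      exact hT.dist_ne_of_adj x hadj (h₁.trans h₂.symm)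
    refine ⟨v, w, .inr hadj, fun g hgs ↦ ?_⟩
    have h₁ := honly (g v) fun u ↦ (hg g hgs v).trans_le (hv u)
    have h₂ := honly (g w) fun u ↦ (hg g hgs w).trans_le (hw u)
    have h₃ := g.injective.ne hvw
    rw [Set.pair_eq_pair_iff]
    grind
  · push Not at hw
    refine ⟨v, v, .inl rfl, fun g hgs ↦ ?_⟩
    have : g v = v := by
      by_contra h
      obtain ⟨u, hu⟩ := hw (g v) (Ne.symm h)
      rw [hg g hgs v] at hu
      exact hu.not_ge (hv u)
    rw [this]

end SimpleGraph

/-- If two involutive permutations have a product of finite order, every point lies in a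
finite set preserved by both. -/
lemma Equiv.Perm.exists_finite_mapsTo_of_involutions {V : Type*} {a b : Equiv.Perm V}
    (ha : a ^ 2 = 1) (hb : b ^ 2 = 1) (hab : IsOfFinOrder (a * b)) (v : V) :
    ∃ s : Set V, v ∈ s ∧ s.Finite ∧ Set.MapsTo a s s ∧ Set.MapsTo b s s := by
  rw [sq] at ha hb
  have hinv : ∀ g ∈ Subgroup.zpowers (a * b), a * g * a ∈ Subgroup.zpowers (a * b) := by
    rintro _ ⟨k, rfl⟩
    refine ⟨-k, ?_⟩
    have ha' : a⁻¹ = a := inv_eq_of_mul_eq_one_left ha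
    have hb' : b⁻¹ = b := inv_eq_of_mul_eq_one_left hb
    have h₁ : a * (a * b) * a⁻¹ = (a * b)⁻¹ := by
      rw [mul_inv_rev, ha', hb', ← mul_assoc, ha, one_mul]
    calc (a * b) ^ (-k) = (a * (a * b) * a⁻¹) ^ k := by rw [h₁, inv_zpow, zpow_neg]
      _ = a * (a * b) ^ k * a := by rw [conj_zpow, ha']
  have hab_mem := Subgroup.mem_zpowers (a * b)
  have hfin : (Subgroup.zpowers (a * b) : Set (Equiv.Perm V)).Finite :=
    finite_zpowers.mpr hab
  set H := Subgroup.zpowers (a * b)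
  have hA : Set.MapsTo a ((fun g : Equiv.Perm V ↦ g v) '' H ∪ (fun g : Equiv.Perm V ↦ g (a v)) '' H)
      ((fun g : Equiv.Perm V ↦ g v) '' H ∪ (fun g : Equiv.Perm V ↦ g (a v)) '' H) := by
    have haa : ∀ x, a (a x) = x := fun x ↦ by rw [← Equiv.Perm.mul_apply, ha, Equiv.Perm.one_apply]
    rintro _ (⟨g, hg, rfl⟩ | ⟨g, hg, rfl⟩)
    · exact .inr ⟨_, hinv g hg, by simp [haa]⟩
    · exact .inl ⟨_, hinv g hg, by simp⟩
  refine ⟨_, .inl ⟨1, H.one_mem, rfl⟩, (hfin.image _).union (hfin.image _), hA, fun x hx ↦ ?_⟩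
  have hbx : b x = a ((a * b) x) := by
    rw [← Equiv.Perm.mul_apply, ← mul_assoc, ha, one_mul]
  rw [hbx]
  refine hA ?_
  rcases hx with ⟨g, hg, rfl⟩ | ⟨g, hg, rfl⟩
  · exact .inl ⟨_, H.mul_mem hab_mem hg, rfl⟩
  · exact .inr ⟨_, H.mul_mem hab_mem hg, rfl⟩

namespace SimpleGraph

variable {V : Type*} {T : SimpleGraph V}

/-- Helly property: tree automorphisms that pairwise preserve a common vertex or edge
together preserve a common vertex or edge. -/
lemma IsTree.exists_common_pair (hT : T.IsTree) (g : Fin 3 → T ≃g T)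
    (h : ∀ i j, i ≠ j → ∃ v w, (v = w ∨ T.Adj v w) ∧
      ({g i v, g i w} : Set V) = {v, w} ∧ ({g j v, g j w} : Set V) = {v, w}) :
    ∃ v w, (v = w ∨ T.Adj v w) ∧ ∀ i, ({g i v, g i w} : Set V) = {v, w} := by
  by_cases hfix : ∀ i, ∃ x, g i x = x
  · have hpair : ∀ i j, i ≠ j → ∃ x, g i x = x ∧ g j x = x := by
      intro i j hij
      obtain ⟨v, w, hvw, hi, hj⟩ := h i j hij
      obtain rfl | hvw := hvw
      · exact ⟨v, by simpa using hi, by simpa using hj⟩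
      obtain ⟨x, hx⟩ := hfix i
      obtain ⟨y, hy⟩ := hfix j
      rw [Set.pair_eq_pair_iff] at hi hj
      exact ⟨v, (hi.resolve_right fun h ↦ hT.apply_ne_of_adj _ hx hvw h.1).1,
        (hj.resolve_right fun h ↦ hT.apply_ne_of_adj _ hy hvw h.1).1⟩
    obtain ⟨x, hx₀, hx₁⟩ := hpair 0 1 (by decide)
    obtain ⟨y, hy₁, hy₂⟩ := hpair 1 2 (by decide)
    obtain ⟨z, hz₂, hz₀⟩ := hpair 2 0 (by decide)
    obtain ⟨m, hxy, hyz, hzx⟩ := hT.exists_median x y z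
    refine ⟨m, m, .inl rfl, fun i ↦ ?_⟩
    suffices g i m = m by rw [this]
    fin_cases i
    · exact hT.apply_eq_of_dist_add_dist_eq _ hz₀ hx₀ hzx
    · exact hT.apply_eq_of_dist_add_dist_eq _ hx₁ hy₁ hxy
    · exact hT.apply_eq_of_dist_add_dist_eq _ hy₂ hz₂ hyz
  · push Not at hfix
    obtain ⟨i, hi⟩ := hfix
    have hedge : ∀ j, i ≠ j → ∃ v w, T.Adj v w ∧ g i v = w ∧ g i w = v ∧
        ({g j v, g j w} : Set V) = {v, w} := by
      intro j hij
      obtain ⟨v, w, hvw, hvi, hvj⟩ := h i j hij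
      rw [Set.pair_eq_pair_iff] at hvi
      have hvi := hvi.resolve_left fun h ↦ hi v h.1
      refine ⟨v, w, hvw.resolve_left ?_, hvi.1, hvi.2, hvj⟩
      rintro rfl
      exact hi v hvi.1
    obtain ⟨k, hk⟩ : ∃ k, i ≠ k := ⟨i + 1, by fin_cases i <;> decide⟩
    obtain ⟨v, w, hvw, hv, hw, -⟩ := hedge k hk
    refine ⟨v, w, .inr hvw, fun j ↦ ?_⟩
    by_cases hij : i = j
    · rw [← hij, hv, hw, Set.pair_comm]
    · obtain ⟨v', w', hvw', hv', -, hj⟩ := hedge j hij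
      have heq := hT.pair_eq_of_swap (g i) hvw hvw' hv hw hv'
      rw [← Set.image_pair] at hj ⊢
      rw [heq, hj]

end SimpleGraph

theorem coxeterTriangleGroup_hasPropertyFA (p q : ℕ) (hp : 0 < p) (hq : 0 < q) :
    HasPropertyFA.{u} (PresentedGroup (coxeterTriangleRels p q)) := by
  intro V T hconn hacyc φ hφ
  have hT : T.IsTree := ⟨hconn, hacyc⟩
  let ρ : Fin 3 → PresentedGroup (coxeterTriangleRels p q) := PresentedGroup.of
  have hrel : ∀ r ∈ coxeterTriangleRels p q, PresentedGroup.mk (coxeterTriangleRels p q) r = 1 :=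
    fun r hr ↦ PresentedGroup.one_of_mem hr
  have hsq : ∀ i, ρ i ^ 2 = 1 := by
    intro i
    have := hrel (FreeGroup.of i ^ 2) (by fin_cases i <;> simp [coxeterTriangleRels])
    rwa [map_pow] at this
  have hpow : ∀ i j n, 0 < n → (FreeGroup.of i * FreeGroup.of j) ^ n ∈ coxeterTriangleRels p q →
      IsOfFinOrder (ρ i * ρ j) := by
    intro i j n hn hmem
    have := hrel _ hmem
    rw [map_pow, map_mul] at this
    exact isOfFinOrder_iff_pow_eq_one.mpr ⟨n, hn, this⟩
  have hsymm : ∀ i j, IsOfFinOrder (ρ i * ρ j) → IsOfFinOrder (ρ j * ρ i) := by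
    intro i j h
    have hinv : ∀ k, (ρ k)⁻¹ = ρ k := fun k ↦ inv_eq_of_mul_eq_one_left (by rw [← sq, hsq])
    simpa [hinv] using h.inv
  have h01 := hpow 0 1 p hp (by simp [coxeterTriangleRels])
  have h12 := hpow 1 2 q hq (by simp [coxeterTriangleRels])
  have h02 := hpow 0 2 2 two_pos (by simp [coxeterTriangleRels])
  have hfin : ∀ i j, i ≠ j → IsOfFinOrder (ρ i * ρ j) := by
    intro i j hij
    fin_cases i <;> fin_cases j <;> first | exact absurd rfl hij | assumption | skip
    all_goals exact hsymm _ _ (by assumption)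
  let g : Fin 3 → T ≃g T := fun i ↦ ⟨φ (ρ i), hφ (ρ i) _ _⟩
  obtain ⟨x⟩ := hconn.nonempty
  obtain ⟨v, w, hvw, hpair⟩ := hT.exists_common_pair g fun i j hij ↦ by
    obtain ⟨s, hxs, hs, hi, hj⟩ := Equiv.Perm.exists_finite_mapsTo_of_involutions
      (a := φ (ρ i)) (b := φ (ρ j)) (by rw [← map_pow, hsq, map_one])
      (by rw [← map_pow, hsq, map_one]) (by rw [← map_mul]; exact φ.isOfFinOrder (hfin i j hij)) x
    obtain ⟨v, w, hvw, h⟩ := hT.exists_center hs ⟨x, hxs⟩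
    exact ⟨v, w, hvw, h (g i) hi, h (g j) hj⟩
  have hall : ∀ c, ({φ c v, φ c w} : Set V) = {v, w} := by
    intro c
    have hc : c ∈ Subgroup.closure (Set.range ρ) := by
      rw [PresentedGroup.closure_range_of]; trivial
    rw [← Set.image_pair]
    induction hc using Subgroup.closure_induction with
    | mem _ h =>
      obtain ⟨i, rfl⟩ := h
      rw [Set.image_pair]
      exact hpair i
    | one => simp
    | mul a b _ _ iha ihb => rw [map_mul, Equiv.Perm.coe_mul, Set.image_comp, ihb, iha]
    | inv a _ ih =>
      conv_lhs => rw [← ih]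
      rw [← Set.image_comp, ← Equiv.Perm.coe_mul, ← map_mul]
      simp
  obtain rfl | hvw := hvw
  · exact .inl ⟨v, fun c ↦ by simpa using hall c⟩
  · exact .inr ⟨v, w, hvw, hall⟩
end

section
/- For all positive integers p and q, the group presented by generators R, S and relations R^p = S^q = (RS)² = 1 (the (2, p, q) rotation triangle group) has property FA. -/
universe u

/-- The relators of the (2, p, q) rotation triangle group on generators `R, S`. -/
def rotationTriangleRels (p q : ℕ) : Set (FreeGroup (Fin 2)) :=
  { (FreeGroup.of 0) ^ p, (FreeGroup.of 1) ^ q,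
    (FreeGroup.of 0 * FreeGroup.of 1) ^ 2 }

namespace SimpleGraph

variable {V : Type*} {T : SimpleGraph V}

lemma Connected.exists_adj_dist_add_one (hT : T.Connected) {x z : V} (hxz : x ≠ z) :
    ∃ y, T.Adj x y ∧ T.dist y z + 1 = T.dist x z := by
  obtain ⟨p, hp⟩ := hT.exists_walk_length_eq_dist x z
  cases p with
  | nil => exact absurd rfl hxz
  | cons h p =>
    rename_i y
    refine ⟨y, h, ?_⟩
    have h₁ := dist_le p
    have h₂ := hT.dist_triangle (u := x) (v := y) (w := z)
    rw [dist_eq_one_iff_adj.2 h] at h₂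
    rw [Walk.length_cons] at hp
    omega

/-- In a tree, the first step of a geodesic is unique. -/
lemma IsTree.eq_of_adj_of_dist_add_one (hT : T.IsTree) {x y y' z : V}
    (hy : T.Adj x y) (hyz : T.dist y z + 1 = T.dist x z)
    (hy' : T.Adj x y') (hyz' : T.dist y' z + 1 = T.dist x z) : y = y' := by
  obtain ⟨p, hp⟩ := hT.1.exists_walk_length_eq_dist y z
  obtain ⟨p', hp'⟩ := hT.1.exists_walk_length_eq_dist y' z
  have h : (Walk.cons hy p).IsPath := Walk.isPath_of_length_eq_dist _ (by simp [hp, hyz])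
  have h' : (Walk.cons hy' p').IsPath := Walk.isPath_of_length_eq_dist _ (by simp [hp', hyz'])
  have := congrArg (fun q : T.Path x z => (q : T.Walk x z).snd)
    ((hT.2.subsingleton_path x z).elim ⟨_, h⟩ ⟨_, h'⟩)
  simpa using this

/-- In a tree, a neighbour of `x` which is not the first step towards `u` is one step further
away from `u`. -/
lemma IsTree.dist_eq_add_one_of_ne (hT : T.IsTree) (u : V) {x y : V} (h : T.Adj x y)
    (hne : T.dist y u + 1 ≠ T.dist x u) : T.dist y u = T.dist x u + 1 := by
  have := hT.dist_eq_dist_add_one_of_adj u h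
  rw [dist_comm (u := u), dist_comm (u := u)] at this
  omega

lemma IsTree.dist_eq_add_of_step (hT : T.IsTree) {u x y w : V} (h : T.Adj x y)
    (hu : T.dist y u = T.dist x u + 1) (hw : T.dist y w + 1 = T.dist x w) :
    T.dist u w = T.dist u x + T.dist x w := by
  induction hn : T.dist y w generalizing x y with
  | zero =>
    have : y = w := hT.1.dist_eq_zero_iff.1 hn
    subst this
    rw [dist_comm, hu, ← hw, hn, dist_comm (u := u)]
  | succ n ih =>
    obtain ⟨z, hz, hzw⟩ := hT.1.exists_adj_dist_add_one (x := y) (z := w) (by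
      rintro rfl; simp at hn)
    have hzu : T.dist z u = T.dist y u + 1 := by
      refine hT.dist_eq_add_one_of_ne u hz fun hzu => ?_
      have : z = x := hT.eq_of_adj_of_dist_add_one hz hzu h.symm hu.symm
      subst this
      omega
    have := ih hz hzu hzw (by omega)
    rw [this, dist_comm (u := u), dist_comm (u := u), hu]
    omega

/-- In a tree, two geodesics issuing from `x` with distinct first steps concatenate to a
geodesic. -/
lemma IsTree.dist_eq_add_of_ne (hT : T.IsTree) {u x y z w : V}
    (hy : T.Adj x y) (hyu : T.dist y u + 1 = T.dist x u)
    (hz : T.Adj x z) (hzw : T.dist z w + 1 = T.dist x w) (hne : y ≠ z) :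
    T.dist u w = T.dist u x + T.dist x w :=
  hT.dist_eq_add_of_step hz (hT.dist_eq_add_one_of_ne u hz fun h =>
    hne (hT.eq_of_adj_of_dist_add_one hy hyu hz h)) hzw

/-- The four-point condition: trees are `0`-hyperbolic. -/
lemma IsTree.dist_add_dist_le_max (hT : T.IsTree) (x y z w : V) :
    T.dist x y + T.dist z w ≤ max (T.dist x z + T.dist y w) (T.dist x w + T.dist y z) := by
  induction hn : T.dist x y generalizing x with
  | zero =>
    have : x = y := hT.1.dist_eq_zero_iff.1 hn
    subst this
    have := hT.1.dist_triangle (u := z) (v := x) (w := w)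
    rw [dist_comm (u := z) (v := x)] at this
    omega
  | succ n ih =>
    obtain ⟨x', hx', hxy⟩ := hT.1.exists_adj_dist_add_one (x := x) (z := y) (by
      rintro rfl; simp at hn)
    have hzw := hT.1.dist_triangle (u := z) (v := x) (w := w)
    have hzx := dist_comm (G := T) (u := z) (v := x)
    have hwx := dist_comm (G := T) (u := w) (v := x)
    by_cases hz : T.dist x' z + 1 = T.dist x z
    · by_cases hw : T.dist x' w + 1 = T.dist x w
      · have := ih x' (by omega)
        omega
      · have := hT.dist_eq_add_of_step hx' (hT.dist_eq_add_one_of_ne w hx' hw) hxy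
        rw [dist_comm (u := w) (v := y)] at this
        omega
    · have := hT.dist_eq_add_of_step hx' (hT.dist_eq_add_one_of_ne z hx' hz) hxy
      rw [dist_comm (u := z) (v := y)] at this
      omega

lemma Connected.dist_map_le {f : V → V} (hT : T.Connected)
    (hf : ∀ v w, T.Adj v w → T.Adj (f v) (f w)) (v w : V) :
    T.dist (f v) (f w) ≤ T.dist v w := by
  obtain ⟨p, hp⟩ := hT.exists_walk_length_eq_dist v w
  rw [← hp, ← Walk.length_map (⟨f, fun h => hf _ _ h⟩ : T →g T) p]
  exact dist_le _

/-- A vertex permutation of finite order which is isometric for the distance of a tree does not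
translate: `g ^ 2` moves no vertex further than `g` does. -/
lemma IsTree.dist_apply_apply_le_of_pow_eq_one (hT : T.IsTree) {g : Equiv.Perm V}
    (hg : ∀ v w, T.dist (g v) (g w) = T.dist v w) {n : ℕ} (hn : 0 < n) (hgn : g ^ n = 1) (x : V) :
    T.dist x (g (g x)) ≤ T.dist x (g x) := by
  by_contra! hlt
  have hstep (k : ℕ) : T.dist ((g ^ k) x) ((g ^ (k + 1)) x) = T.dist x (g x) := by
    induction k with
    | zero => simp
    | succ k ih => rw [pow_succ' g k, pow_succ' g (k + 1), Equiv.Perm.mul_apply,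
        Equiv.Perm.mul_apply, hg, ih]
  have hstep₂ (k : ℕ) : T.dist ((g ^ k) x) ((g ^ (k + 2)) x) = T.dist x (g (g x)) := by
    induction k with
    | zero => simp [pow_two]
    | succ k ih => rw [pow_succ' g k, show k + 1 + 2 = (k + 2) + 1 by omega, pow_succ' g (k + 2),
        Equiv.Perm.mul_apply, Equiv.Perm.mul_apply, hg, ih]
  have hmono : StrictMono fun k => T.dist x ((g ^ k) x) := by
    refine strictMono_nat_of_lt_succ fun k => ?_
    induction k with
    | zero =>
      have hne : x ≠ g x := by
        intro h
        rw [← h, ← h] at hlt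
        simp at hlt
      simpa using hT.1.pos_dist_of_ne hne
    | succ k ih =>
      have h := hT.dist_add_dist_le_max x ((g ^ (k + 1)) x) ((g ^ k) x) ((g ^ (k + 2)) x)
      have h₁ := hstep k
      have h₂ := hstep (k + 1)
      have h₃ := hstep₂ k
      rw [dist_comm] at h₁
      simp only [add_assoc, one_add_one_eq_two] at *
      omega
  have := hmono hn
  simp [hgn] at this

/-- The first step from `x` towards `g x`, for an isometric permutation `g` that does not translate:
either it is `g x` and `g` inverts the edge joining them, or `g` moves it by two less than `x`. -/
lemma IsTree.exists_adj_step (hT : T.IsTree) {g : Equiv.Perm V}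
    (hg : ∀ v w, T.dist (g v) (g w) = T.dist v w)
    (hell : ∀ x, T.dist x (g (g x)) ≤ T.dist x (g x)) {x : V} (hx : g x ≠ x) :
    ∃ y, T.Adj x y ∧ T.dist y (g x) + 1 = T.dist x (g x) ∧
      T.dist y (g.symm x) + 1 = T.dist x (g.symm x) ∧
      (g x = y ∧ g y = x ∨ T.dist y (g y) + 2 = T.dist x (g x)) := by
  have hinv : T.dist x (g.symm x) = T.dist x (g x) := by
    rw [← hg x (g.symm x), Equiv.apply_symm_apply, dist_comm]
  have hpos := hT.1.pos_dist_of_ne hx.symm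
  obtain ⟨y, hy, hyg⟩ := hT.1.exists_adj_dist_add_one hx.symm
  obtain ⟨z, hz, hzg⟩ := hT.1.exists_adj_dist_add_one (x := x) (z := g.symm x) (by
    intro h; rw [← h] at hinv; simp at hinv; omega)
  have hyz : y = z := by
    by_contra hne
    have h₁ := hT.dist_eq_add_of_ne hy hyg hz hzg hne
    have h₂ := hell (g.symm x)
    rw [Equiv.apply_symm_apply] at h₂
    have h₃ := dist_comm (G := T) (u := g.symm x) (v := g x)
    have h₄ := dist_comm (G := T) (u := g.symm x) (v := x)
    have h₅ := dist_comm (G := T) (u := g x) (v := x)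
    omega
  subst hyz
  refine ⟨y, hy, hyg, hzg, ?_⟩
  have hgy : T.Adj (g x) (g y) := by
    rw [← dist_eq_one_iff_adj, hg, dist_eq_one_iff_adj]
    exact hy
  have hgyx : T.dist (g y) x + 1 = T.dist (g x) x := by
    have h₁ := hg y (g.symm x)
    have h₂ := dist_comm (G := T) (u := g x) (v := x)
    rw [Equiv.apply_symm_apply] at h₁
    omega
  by_cases hgxy : g x = y
  · refine Or.inl ⟨hgxy, ?_⟩
    rw [← hT.1.dist_eq_zero_iff]
    have h₁ := dist_comm (G := T) (u := g x) (v := x)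
    rw [hgxy, dist_self] at hyg
    rw [hgxy] at h₁ hgyx
    omega
  · right
    obtain ⟨w, hw, hwy⟩ := hT.1.exists_adj_dist_add_one hgxy
    have hwx : T.dist w x + 1 = T.dist (g x) x := by
      have h₁ := hT.1.dist_triangle (u := w) (v := y) (w := x)
      have h₂ := hT.1.dist_triangle (u := g x) (v := w) (w := x)
      rw [dist_eq_one_iff_adj.2 hy.symm] at h₁
      rw [dist_eq_one_iff_adj.2 hw] at h₂
      have h₃ := dist_comm (G := T) (u := g x) (v := x)
      have h₄ := dist_comm (G := T) (u := g x) (v := y)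
      omega
    have := hT.eq_of_adj_of_dist_add_one hgy hgyx hw hwx
    subst this
    have h₃ := dist_comm (G := T) (u := g y) (v := y)
    have h₄ := dist_comm (G := T) (u := g x) (v := y)
    omega

/-- Let `x` be a vertex where the sum of the displacements of `a` and `b` is minimal. If `a` fixes
`x` and `b` does not, then some edge at `x` is invariant under both. -/
lemma IsTree.exists_invariant_edge_of_apply_eq (hT : T.IsTree) {a b : Equiv.Perm V}
    (ha : ∀ v w, T.dist (a v) (a w) = T.dist v w)
    (hb : ∀ v w, T.dist (b v) (b w) = T.dist v w)
    (hbell : ∀ x, T.dist x (b (b x)) ≤ T.dist x (b x))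
    (hab : ∀ x, a (b (a (b x))) = x) {x : V}
    (hmin : ∀ y, T.dist x (a x) + T.dist x (b x) ≤ T.dist y (a y) + T.dist y (b y))
    (hax : a x = x) (hbx : b x ≠ x) :
    ∃ y, T.Adj x y ∧ a '' {x, y} = {x, y} ∧ b '' {x, y} = {x, y} := by
  obtain ⟨y, hy, hyb, hyb', hcase⟩ := hT.exists_adj_step hb hbell hbx
  have habx : a (b x) = b.symm x := by
    rw [Equiv.eq_symm_apply, ← a.injective.eq_iff, hab, hax]
  have hay : y = a y := by
    refine hT.eq_of_adj_of_dist_add_one (z := b.symm x) hy hyb' ?_ ?_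
    · rw [← dist_eq_one_iff_adj]
      nth_rw 1 [← hax]
      rw [ha, dist_eq_one_iff_adj]
      exact hy
    · rw [← habx, ha]
      nth_rw 2 [← hax]
      rw [ha, hyb]
  refine ⟨y, hy, ?_⟩
  rcases hcase with ⟨h₁, h₂⟩ | h
  · rw [Set.image_pair, Set.image_pair, hax, ← hay, h₁, h₂]
    exact ⟨rfl, Set.pair_comm _ _⟩
  · have := hmin y
    rw [hax, ← hay, dist_self, dist_self] at this
    omega

/-- Two non-translating isometric permutations of a tree whose product is an involution have a
common fixed vertex or a common invariant edge. -/
lemma IsTree.exists_fixed_or_invariant_edge (hT : T.IsTree) {a b : Equiv.Perm V}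
    (ha : ∀ v w, T.dist (a v) (a w) = T.dist v w)
    (hb : ∀ v w, T.dist (b v) (b w) = T.dist v w)
    (haell : ∀ x, T.dist x (a (a x)) ≤ T.dist x (a x))
    (hbell : ∀ x, T.dist x (b (b x)) ≤ T.dist x (b x))
    (hab : ∀ x, a (b (a (b x))) = x) :
    (∃ x, a x = x ∧ b x = x) ∨
      ∃ x y, T.Adj x y ∧ a '' {x, y} = {x, y} ∧ b '' {x, y} = {x, y} := by
  have hba (x : V) : b (a (b (a x))) = x := a.injective (hab (a x))
  have := hT.1.nonempty
  let F (x : V) : ℕ := T.dist x (a x) + T.dist x (b x)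
  let x : V := Function.argmin F
  have hmin (y : V) : T.dist x (a x) + T.dist x (b x) ≤ T.dist y (a y) + T.dist y (b y) :=
    Function.argmin_le F y
  by_cases hax : a x = x
  · by_cases hbx : b x = x
    · exact Or.inl ⟨x, hax, hbx⟩
    · exact Or.inr ⟨x, hT.exists_invariant_edge_of_apply_eq ha hb hbell hab hmin hax hbx⟩
  right
  by_cases hbx : b x = x
  · obtain ⟨y, hy, h₁, h₂⟩ := hT.exists_invariant_edge_of_apply_eq hb ha haell hba
      (fun y => by have := hmin y; omega) hbx hax
    exact ⟨x, y, hy, h₂, h₁⟩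
  obtain ⟨y, hy, hya, hya', hcase⟩ := hT.exists_adj_step ha haell hax
  obtain ⟨z, hz, hzb, hzb', hcase'⟩ := hT.exists_adj_step hb hbell hbx
  have hyz : y = z := by
    by_contra hne
    have hgeo := hT.dist_eq_add_of_ne hy hya' hz hzb hne
    have habx : a (b x) = b.symm (a.symm x) := by
      rw [Equiv.eq_symm_apply, Equiv.eq_symm_apply, hab]
    have hainv : T.dist x (a x) = T.dist x (a.symm x) := by
      rw [← ha x (a.symm x), Equiv.apply_symm_apply, dist_comm]
    have hxab : T.dist x (a (b x)) = T.dist x (a x) + T.dist x (b x) := by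
      rw [← ha, Equiv.apply_symm_apply, dist_comm (v := x)] at hgeo
      omega
    have hbinv : T.dist (b.symm x) (b.symm (a.symm x)) = T.dist x (a.symm x) := by
      rw [← hb, Equiv.apply_symm_apply, Equiv.apply_symm_apply]
    have hbinv' : T.dist x (b x) = T.dist x (b.symm x) := by
      rw [← hb x (b.symm x), Equiv.apply_symm_apply, dist_comm]
    have h₁ := hT.1.dist_triangle (u := y) (v := a x) (w := a (b x))
    have h₂ := hT.1.dist_triangle (u := z) (v := b.symm x) (w := a (b x))
    have h₃ := hT.1.dist_triangle (u := x) (v := y) (w := a (b x))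
    have h₄ := hT.1.dist_triangle (u := x) (v := z) (w := a (b x))
    rw [ha] at h₁
    rw [habx, hbinv, ← habx] at h₂
    rw [dist_eq_one_iff_adj.2 hy] at h₃
    rw [dist_eq_one_iff_adj.2 hz] at h₄
    exact hne (hT.eq_of_adj_of_dist_add_one (z := a (b x)) hy (by omega) hz (by omega))
  subst hyz
  have hyx := dist_eq_one_iff_adj.2 hy.symm
  have hy_min := hmin y
  rcases hcase with ⟨h₁, h₂⟩ | h <;> rcases hcase' with ⟨h₁', h₂'⟩ | h'
  · refine ⟨x, y, hy, ?_, ?_⟩ <;> rw [Set.image_pair]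
    · rw [h₁, h₂, Set.pair_comm]
    · rw [h₁', h₂', Set.pair_comm]
  · rw [h₁, h₂] at hy_min
    omega
  · rw [h₁', h₂'] at hy_min
    omega
  · omega

end SimpleGraph

lemma PresentedGroup.image_eq_of_forall_of {α V : Type*} {rels : Set (FreeGroup α)}
    (φ : PresentedGroup rels →* Equiv.Perm V) {s : Set V}
    (h : ∀ i, φ (PresentedGroup.of i) '' s = s) (g : PresentedGroup rels) : φ g '' s = s := by
  have hg : g ∈ Subgroup.closure (Set.range (PresentedGroup.of (rels := rels))) := by
    rw [PresentedGroup.closure_range_of]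
    trivial
  induction hg using Subgroup.closure_induction with
  | mem x hx =>
    obtain ⟨i, rfl⟩ := hx
    exact h i
  | one => simp
  | mul x y _ _ hx hy => rw [map_mul, Equiv.Perm.coe_mul, Set.image_comp, hy, hx]
  | inv x _ hx =>
    nth_rw 1 [← hx]
    rw [← Set.image_comp, ← Equiv.Perm.coe_mul, map_inv, inv_mul_cancel]
    simp

theorem rotationTriangleGroup_hasPropertyFA (p q : ℕ) (hp : 0 < p) (hq : 0 < q) :
    HasPropertyFA.{u} (PresentedGroup (rotationTriangleRels p q)) := by
  intro V T hconn hacyc φ hφ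
  have hT : T.IsTree := ⟨hconn, hacyc⟩
  have hiso (g : PresentedGroup (rotationTriangleRels p q)) (v w : V) :
      T.dist (φ g v) (φ g w) = T.dist v w := by
    refine le_antisymm (hconn.dist_map_le (fun v w => (hφ g v w).2) v w) ?_
    simpa using hconn.dist_map_le (fun v w => (hφ g⁻¹ v w).2) (φ g v) (φ g w)
  have hR : (PresentedGroup.of 0 : PresentedGroup (rotationTriangleRels p q)) ^ p = 1 :=
    PresentedGroup.one_of_mem (by simp [rotationTriangleRels])
  have hS : (PresentedGroup.of 1 : PresentedGroup (rotationTriangleRels p q)) ^ q = 1 :=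
    PresentedGroup.one_of_mem (by simp [rotationTriangleRels])
  have hRS : ((PresentedGroup.of 0 : PresentedGroup (rotationTriangleRels p q)) *
      PresentedGroup.of 1) ^ 2 = 1 :=
    PresentedGroup.one_of_mem (by simp [rotationTriangleRels])
  have hinv (x : V) : φ (.of 0) (φ (.of 1) (φ (.of 0) (φ (.of 1) x))) = x := by
    have := congrArg (fun g => φ g x) hRS
    simpa [pow_two] using this
  rcases hT.exists_fixed_or_invariant_edge (hiso (.of 0)) (hiso (.of 1))
    (hT.dist_apply_apply_le_of_pow_eq_one (hiso _) hp (by rw [← map_pow, hR, map_one]))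
    (hT.dist_apply_apply_le_of_pow_eq_one (hiso _) hq (by rw [← map_pow, hS, map_one]))
    hinv with ⟨x, h₀, h₁⟩ | ⟨x, y, hxy, h₀, h₁⟩
  · refine Or.inl ⟨x, fun g => ?_⟩
    have := PresentedGroup.image_eq_of_forall_of φ (s := {x})
      (by intro i; fin_cases i <;> simp [h₀, h₁]) g
    simpa using this
  · refine Or.inr ⟨x, y, hxy, fun g => ?_⟩
    rw [← Set.image_pair]
    refine PresentedGroup.image_eq_of_forall_of φ (fun i => ?_) g
    fin_cases i
    exacts [h₀, h₁]
end
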